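/- Let A be the linear map on ℝ² given by the matrix [[2,1],[1,1]], considered with the Euclidean metric, and let K = [0,1]². Let γ = (3+√5)/2, so that the eigenvalues of A have absolute values γ and γ^{−1}. Then for every α ≥ 0, the estimation entropy (computed with the natural logarithm) satisfies h_est(α,K;A) = α + ln γ if 0 ≤ α ≤ ln γ, and h_est(α,K;A) = 2α if α ≥ ln γ; equivalently, h_est(α,K;A) = (ln γ + α)⁺ + (−ln γ + α)⁺, where s⁺ = max{0,s}. -/

import Mathlib

open Filter Metric Set

/-- Minimal cardinality of an `(n,ε,α,K)`-spanning set for a map `g`. -/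
noncomputable def spanNum {X : Type*} [MetricSpace X] (g : X → X) (K : Set X)
    (α : ℝ) (n : ℕ) (ε : ℝ) : ℕ :=
  sInf {m : ℕ | ∃ S : Finset X, ↑S ⊆ K ∧ S.card = m ∧
    ∀ x ∈ K, ∃ y ∈ S, ∀ t : ℕ, t ≤ n →
      dist (g^[t] x) (g^[t] y) < ε * Real.exp (-α * t)}

/-- Estimation entropy (natural logarithm); the limit as `ε ↓ 0` is realized as the
supremum over `ε > 0`, by monotonicity. -/
noncomputable def estEntropy {X : Type*} [MetricSpace X] (g : X → X) (K : Set X)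
    (α : ℝ) : EReal :=
  ⨆ ε ∈ Set.Ioi (0 : ℝ),
    atTop.limsup fun n : ℕ => ((Real.log (spanNum g K α n ε) / n : ℝ) : EReal)

/-- The linear map on `ℝ²` (with the Euclidean metric) given by the matrix
`[[2,1],[1,1]]`. -/
noncomputable def catMap : EuclideanSpace ℝ (Fin 2) → EuclideanSpace ℝ (Fin 2) :=
  fun x => (WithLp.equiv 2 (Fin 2 → ℝ)).symm ![2 * x 0 + x 1, x 0 + x 1]

/-- The unit square `[0,1]² ⊆ ℝ²`. -/
def unitSquare : Set (EuclideanSpace ℝ (Fin 2)) :=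
  {x | ∀ i, x i ∈ Set.Icc (0 : ℝ) 1}

/-- The unstable coordinate of the cat map. -/
noncomputable def catU (x : EuclideanSpace ℝ (Fin 2)) : ℝ := Real.goldenRatio * x 0 + x 1

/-- The stable coordinate of the cat map. -/
noncomputable def catV (x : EuclideanSpace ℝ (Fin 2)) : ℝ := x 0 - Real.goldenRatio * x 1

/-- The logarithm of the unstable eigenvalue of the cat map. -/
noncomputable def catL : ℝ := Real.log ((3 + Real.sqrt 5) / 2)

theorem goldenRatio_bounds : 3 / 2 < Real.goldenRatio ∧ Real.goldenRatio < 17 / 10 := by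
  have h5 : Real.sqrt 5 ^ 2 = 5 := Real.sq_sqrt (by norm_num)
  have h0 : 0 ≤ Real.sqrt 5 := Real.sqrt_nonneg 5
  unfold Real.goldenRatio
  constructor <;> nlinarith

theorem exp_catL : Real.exp catL = Real.goldenRatio + 1 := by
  rw [catL, Real.exp_log (by positivity), Real.goldenRatio]
  ring

theorem exp_neg_catL : Real.exp (-catL) = 2 - Real.goldenRatio := by
  rw [Real.exp_neg, exp_catL]
  apply inv_eq_of_mul_eq_one_right
  linear_combination -Real.goldenRatio_sq

theorem catL_pos : 0 < catL := by
  apply Real.log_pos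
  have : 0 ≤ Real.sqrt 5 := Real.sqrt_nonneg 5
  linarith

theorem catU_catMap (x : EuclideanSpace ℝ (Fin 2)) :
    catU (catMap x) = Real.exp catL * catU x := by
  rw [exp_catL]
  simp only [catU, catMap, WithLp.equiv_symm_apply, Matrix.cons_val_zero, Matrix.cons_val_one]
  linear_combination -x 0 * Real.goldenRatio_sq

theorem catV_catMap (x : EuclideanSpace ℝ (Fin 2)) :
    catV (catMap x) = Real.exp (-catL) * catV x := by
  rw [exp_neg_catL]
  simp only [catV, catMap, WithLp.equiv_symm_apply, Matrix.cons_val_zero, Matrix.cons_val_one]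
  linear_combination -x 1 * Real.goldenRatio_sq

theorem catU_iterate (t : ℕ) (x : EuclideanSpace ℝ (Fin 2)) :
    catU (catMap^[t] x) = Real.exp (catL * t) * catU x := by
  induction t with
  | zero => simp
  | succ t ih =>
    rw [Function.iterate_succ_apply', catU_catMap, ih, ← mul_assoc, ← Real.exp_add]
    push_cast
    ring_nf

theorem catV_iterate (t : ℕ) (x : EuclideanSpace ℝ (Fin 2)) :
    catV (catMap^[t] x) = Real.exp (-catL * t) * catV x := by
  induction t with
  | zero => simp
  | succ t ih =>
    rw [Function.iterate_succ_apply', catV_catMap, ih, ← mul_assoc, ← Real.exp_add]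
    push_cast
    ring_nf

theorem catU_sub_sq_add_catV_sub_sq (x y : EuclideanSpace ℝ (Fin 2)) :
    (catU x - catU y) ^ 2 + (catV x - catV y) ^ 2
      = (Real.goldenRatio + 2) * dist x y ^ 2 := by
  rw [EuclideanSpace.dist_eq, Real.sq_sqrt (by positivity), Fin.sum_univ_two, Real.dist_eq,
    Real.dist_eq, sq_abs, sq_abs, catU, catU, catV, catV]
  linear_combination ((x 0 - y 0) ^ 2 + (x 1 - y 1) ^ 2) * Real.goldenRatio_sq

theorem abs_catU_sub_le (x y : EuclideanSpace ℝ (Fin 2)) :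
    |catU x - catU y| ≤ 2 * dist x y := by
  have h := catU_sub_sq_add_catV_sub_sq x y
  have hg := goldenRatio_bounds
  apply abs_le_of_sq_le_sq _ (by positivity)
  nlinarith [sq_nonneg (catV x - catV y), sq_nonneg (dist x y)]

theorem abs_catV_sub_le (x y : EuclideanSpace ℝ (Fin 2)) :
    |catV x - catV y| ≤ 2 * dist x y := by
  have h := catU_sub_sq_add_catV_sub_sq x y
  have hg := goldenRatio_bounds
  apply abs_le_of_sq_le_sq _ (by positivity)
  nlinarith [sq_nonneg (catU x - catU y), sq_nonneg (dist x y)]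

theorem dist_le_abs_catU_sub_add (x y : EuclideanSpace ℝ (Fin 2)) :
    dist x y ≤ |catU x - catU y| + |catV x - catV y| := by
  have h := catU_sub_sq_add_catV_sub_sq x y
  have hg := goldenRatio_bounds
  apply le_of_sq_le_sq _ (by positivity)
  rw [← sq_abs (catU x - catU y), ← sq_abs (catV x - catV y)] at h
  nlinarith [sq_nonneg (dist x y), abs_nonneg (catU x - catU y), abs_nonneg (catV x - catV y),
    mul_nonneg (abs_nonneg (catU x - catU y)) (abs_nonneg (catV x - catV y))]

/-- The exponential rate of the number of cells needed in the stable direction. -/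
noncomputable def catB (α : ℝ) : ℝ := max 0 (-catL + α)

theorem dist_iterate_lt_of_abs_lt {α ε : ℝ} (hα : 0 ≤ α) {n : ℕ}
    {x y : EuclideanSpace ℝ (Fin 2)}
    (hu : |catU x - catU y| < ε / 2 * Real.exp (-(catL + α) * n))
    (hv : |catV x - catV y| < ε / 2 * Real.exp (-catB α * n)) (hε : 0 < ε)
    {t : ℕ} (ht : t ≤ n) :
    dist (catMap^[t] x) (catMap^[t] y) < ε * Real.exp (-α * t) := by
  have htn : (t : ℝ) ≤ n := by exact_mod_cast ht
  have hL := catL_pos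
  have ht0 : (0 : ℝ) ≤ t := by positivity
  have hb0 : 0 ≤ catB α := le_max_left _ _
  have hb1 : -catL + α ≤ catB α := le_max_right _ _
  refine (dist_le_abs_catU_sub_add _ _).trans_lt ?_
  rw [catU_iterate, catU_iterate, catV_iterate, catV_iterate, ← mul_sub, ← mul_sub, abs_mul,
    abs_mul, Real.abs_exp, Real.abs_exp]
  have h1 : Real.exp (catL * t) * |catU x - catU y| < ε / 2 * Real.exp (-α * t) := by
    calc _ < Real.exp (catL * t) * (ε / 2 * Real.exp (-(catL + α) * n)) := by gcongr
      _ = ε / 2 * Real.exp (catL * t + -(catL + α) * n) := by rw [Real.exp_add]; ring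
      _ ≤ _ := by
        gcongr
        nlinarith
  have h2 : Real.exp (-catL * t) * |catV x - catV y| < ε / 2 * Real.exp (-α * t) := by
    calc _ < Real.exp (-catL * t) * (ε / 2 * Real.exp (-catB α * n)) := by gcongr
      _ = ε / 2 * Real.exp (-catL * t + -catB α * n) := by rw [Real.exp_add]; ring
      _ ≤ _ := by
        gcongr
        nlinarith
  linarith

/-- A set on which `f` takes values in a finite set `T` contains at most `T.card` points
representing all the fibres. -/
theorem exists_finset_fiber_representatives {X ι : Type*} (K : Set X) (f : X → ι)
    (T : Finset ι) (hf : ∀ x ∈ K, f x ∈ T) :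
    ∃ S : Finset X, ↑S ⊆ K ∧ S.card ≤ T.card ∧ ∀ x ∈ K, ∃ y ∈ S, f x = f y := by
  classical
  have hfin : (f '' K).Finite := T.finite_toSet.subset (by rintro _ ⟨x, hx, rfl⟩; exact hf x hx)
  obtain ⟨S, hSK, hbij⟩ := (Set.surjOn_image f K).exists_bijOn_subset
  have hS := hbij.image_eq
  have hinj := hbij.injOn
  have hSfin : S.Finite := Set.Finite.of_finite_image (hS ▸ hfin) hinj
  refine ⟨hSfin.toFinset, by simpa using hSK, ?_, fun x hx => ?_⟩
  · refine Finset.card_le_card_of_injOn f (fun x hx => hf x (hSK (by simpa using hx))) ?_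
    simpa using hinj
  · obtain ⟨y, hy, h⟩ := hS.symm ▸ Set.mem_image_of_mem f hx
    exact ⟨y, by simpa using hy, h.symm⟩

theorem card_Icc_floor_div_le {ε δ : ℝ} (hδ : 0 < δ) (h : δ ≤ ε / 2) :
    ((Finset.Icc ⌊-3 / δ⌋ ⌊3 / δ⌋).card : ℝ) ≤ (6 + ε) / δ := by
  have hle : ⌊-3 / δ⌋ ≤ ⌊3 / δ⌋ + 1 := by
    have : ⌊-3 / δ⌋ ≤ ⌊3 / δ⌋ := by
      gcongr
      norm_num
    lia
  have hcard : ((Finset.Icc ⌊-3 / δ⌋ ⌊3 / δ⌋).card : ℝ) = ⌊3 / δ⌋ + 1 - ⌊-3 / δ⌋ := by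
    have := Int.card_Icc_of_le ⌊-3 / δ⌋ ⌊3 / δ⌋ hle
    exact_mod_cast this
  rw [hcard]
  have h1 := Int.floor_le (3 / δ)
  have h2 := Int.lt_floor_add_one (-3 / δ)
  have h3 : 2 ≤ ε / δ := by
    rw [le_div_iff₀ hδ]
    linarith
  have h4 : (6 + ε) / δ = 3 / δ - -3 / δ + ε / δ := by ring
  linarith

theorem abs_catU_le {x : EuclideanSpace ℝ (Fin 2)} (hx : x ∈ unitSquare) : |catU x| ≤ 3 := by
  have hg := goldenRatio_bounds
  obtain ⟨h0, h0'⟩ := hx 0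
  obtain ⟨h1, h1'⟩ := hx 1
  rw [abs_le, catU]
  constructor <;> nlinarith

theorem abs_catV_le {x : EuclideanSpace ℝ (Fin 2)} (hx : x ∈ unitSquare) : |catV x| ≤ 3 := by
  have hg := goldenRatio_bounds
  obtain ⟨h0, h0'⟩ := hx 0
  obtain ⟨h1, h1'⟩ := hx 1
  rw [abs_le, catV]
  constructor <;> nlinarith

theorem floor_div_mem_Icc {w δ : ℝ} (hδ : 0 < δ) (hw : |w| ≤ 3) :
    ⌊w / δ⌋ ∈ Finset.Icc ⌊-3 / δ⌋ ⌊3 / δ⌋ := by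
  obtain ⟨h1, h2⟩ := abs_le.1 hw
  rw [Finset.mem_Icc]
  constructor <;> gcongr

theorem abs_sub_lt_of_floor_div_eq {w z δ : ℝ} (hδ : 0 < δ) (h : ⌊w / δ⌋ = ⌊z / δ⌋) :
    |w - z| < δ := by
  have := Int.abs_sub_lt_one_of_floor_eq_floor h
  rwa [← sub_div, abs_div, abs_of_pos hδ, div_lt_one hδ] at this

theorem exists_spanning_catMap {α ε : ℝ} (hα : 0 ≤ α) (hε : 0 < ε) (n : ℕ) :
    ∃ S : Finset (EuclideanSpace ℝ (Fin 2)), ↑S ⊆ unitSquare ∧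
      (S.card : ℝ) ≤ (2 * (6 + ε) / ε) ^ 2 * Real.exp ((catL + α + catB α) * n) ∧
      ∀ x ∈ unitSquare, ∃ y ∈ S, ∀ t : ℕ, t ≤ n →
        dist (catMap^[t] x) (catMap^[t] y) < ε * Real.exp (-α * t) := by
  have hL := catL_pos
  have hb : 0 ≤ catB α := le_max_left _ _
  set δ₁ := ε / 2 * Real.exp (-(catL + α) * n) with hδ₁
  set δ₂ := ε / 2 * Real.exp (-catB α * n) with hδ₂
  have hp₁ : 0 < δ₁ := by positivity
  have hp₂ : 0 < δ₂ := by positivity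
  have hn : (0 : ℝ) ≤ n := by positivity
  have hl₁ : δ₁ ≤ ε / 2 := mul_le_of_le_one_right (by positivity)
    (Real.exp_le_one_iff.2 (by nlinarith))
  have hl₂ : δ₂ ≤ ε / 2 := mul_le_of_le_one_right (by positivity)
    (Real.exp_le_one_iff.2 (by nlinarith))
  obtain ⟨S, hSK, hcard, hS⟩ := exists_finset_fiber_representatives unitSquare
    (fun x => (⌊catU x / δ₁⌋, ⌊catV x / δ₂⌋))
    (Finset.Icc ⌊-3 / δ₁⌋ ⌊3 / δ₁⌋ ×ˢ Finset.Icc ⌊-3 / δ₂⌋ ⌊3 / δ₂⌋)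
    (fun x hx => Finset.mem_product.2 ⟨floor_div_mem_Icc hp₁ (abs_catU_le hx),
      floor_div_mem_Icc hp₂ (abs_catV_le hx)⟩)
  refine ⟨S, hSK, ?_, fun x hx => ?_⟩
  · rw [Finset.card_product] at hcard
    calc (S.card : ℝ) ≤ (Finset.Icc ⌊-3 / δ₁⌋ ⌊3 / δ₁⌋).card
          * (Finset.Icc ⌊-3 / δ₂⌋ ⌊3 / δ₂⌋).card := by exact_mod_cast hcard
      _ ≤ (6 + ε) / δ₁ * ((6 + ε) / δ₂) := by
        gcongr
        · exact card_Icc_floor_div_le hp₁ hl₁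
        · exact card_Icc_floor_div_le hp₂ hl₂
      _ = _ := by
        rw [add_mul, Real.exp_add, hδ₁, hδ₂, neg_mul, neg_mul, Real.exp_neg, Real.exp_neg]
        field_simp
  · obtain ⟨y, hy, hxy⟩ := hS x hx
    obtain ⟨h1, h2⟩ := Prod.mk.inj hxy
    exact ⟨y, hy, fun t ht => dist_iterate_lt_of_abs_lt hα (abs_sub_lt_of_floor_div_eq hp₁ h1)
      (abs_sub_lt_of_floor_div_eq hp₂ h2) hε ht⟩

theorem spanNum_catMap_le {α ε : ℝ} (hα : 0 ≤ α) (hε : 0 < ε) (n : ℕ) :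
    (spanNum catMap unitSquare α n ε : ℝ)
      ≤ (2 * (6 + ε) / ε) ^ 2 * Real.exp ((catL + α + catB α) * n) := by
  obtain ⟨S, hSK, hcard, hS⟩ := exists_spanning_catMap hα hε n
  have hle : spanNum catMap unitSquare α n ε ≤ S.card := Nat.sInf_le ⟨S, hSK, rfl, hS⟩
  exact le_trans (by exact_mod_cast hle) hcard

/-- The point whose unstable and stable coordinates exceed those of the centre of the unit
square by `p` and `q`. -/
noncomputable def catPoint (p q : ℝ) : EuclideanSpace ℝ (Fin 2) :=
  !₂[1 / 2 + (Real.goldenRatio * p + q) / (Real.goldenRatio + 2),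
    1 / 2 + (p - Real.goldenRatio * q) / (Real.goldenRatio + 2)]

theorem catU_catPoint (p q : ℝ) : catU (catPoint p q) = (Real.goldenRatio + 1) / 2 + p := by
  have hg := goldenRatio_bounds
  have : Real.goldenRatio + 2 ≠ 0 := by linarith
  simp only [catU, catPoint, PiLp.toLp_apply, Matrix.cons_val_zero, Matrix.cons_val_one]
  field_simp
  linear_combination 8 * p * Real.goldenRatio_sq

theorem catV_catPoint (p q : ℝ) : catV (catPoint p q) = (1 - Real.goldenRatio) / 2 + q := by
  have hg := goldenRatio_bounds
  have : Real.goldenRatio + 2 ≠ 0 := by linarith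
  simp only [catV, catPoint, PiLp.toLp_apply, Matrix.cons_val_zero, Matrix.cons_val_one]
  field_simp
  linear_combination 8 * q * Real.goldenRatio_sq

theorem catPoint_mem_unitSquare {p q : ℝ} (hp : p ∈ Icc (0 : ℝ) (1 / 2))
    (hq : q ∈ Icc (0 : ℝ) (1 / 2)) : catPoint p q ∈ unitSquare := by
  obtain ⟨hp0, hp1⟩ := hp
  obtain ⟨hq0, hq1⟩ := hq
  have hg := goldenRatio_bounds
  have hpos : 0 < Real.goldenRatio + 2 := by linarith
  have key : ∀ w, |w| ≤ (Real.goldenRatio + 2) / 2 →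
      1 / 2 + w / (Real.goldenRatio + 2) ∈ Icc (0 : ℝ) 1 := by
    intro w hw
    obtain ⟨h1, h2⟩ := abs_le.1 hw
    have h3 : -(1 / 2) ≤ w / (Real.goldenRatio + 2) := by
      rw [le_div_iff₀ hpos]
      linarith
    have h4 : w / (Real.goldenRatio + 2) ≤ 1 / 2 := by
      rw [div_le_iff₀ hpos]
      linarith
    constructor <;> linarith
  intro i
  fin_cases i
  · exact key _ (abs_le.2 ⟨by nlinarith, by nlinarith⟩)
  · exact key _ (abs_le.2 ⟨by nlinarith, by nlinarith⟩)

theorem abs_sub_lt_of_dist_iterate_lt {α : ℝ} {n : ℕ} {x y : EuclideanSpace ℝ (Fin 2)}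
    (h : ∀ t : ℕ, t ≤ n → dist (catMap^[t] x) (catMap^[t] y) < 1 * Real.exp (-α * t)) :
    |catU x - catU y| < 2 * Real.exp (-(catL + α) * n) ∧
      |catV x - catV y| < 2 * Real.exp (-catB α * n) := by
  have h0 := h 0 (Nat.zero_le n)
  have hn := h n le_rfl
  constructor
  · have h1 := (abs_catU_sub_le _ _).trans_lt (mul_lt_mul_of_pos_left hn two_pos)
    rw [catU_iterate, catU_iterate, ← mul_sub, abs_mul, Real.abs_exp] at h1
    calc |catU x - catU y|
        = Real.exp (-catL * n) * (Real.exp (catL * n) * |catU x - catU y|) := by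
          rw [← mul_assoc, ← Real.exp_add]
          simp
      _ < Real.exp (-catL * n) * (2 * (1 * Real.exp (-α * n))) := by gcongr
      _ = 2 * Real.exp (-catL * n + -α * n) := by rw [Real.exp_add]; ring
      _ = _ := by ring_nf
  · rcases le_total (-catL + α) 0 with hb | hb
    · have h1 := (abs_catV_sub_le _ _).trans_lt (mul_lt_mul_of_pos_left h0 two_pos)
      simpa [catB, max_eq_left hb] using h1
    · have h1 := (abs_catV_sub_le _ _).trans_lt (mul_lt_mul_of_pos_left hn two_pos)
      rw [catV_iterate, catV_iterate, ← mul_sub, abs_mul, Real.abs_exp] at h1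
      rw [catB, max_eq_right hb]
      calc |catV x - catV y|
          = Real.exp (catL * n) * (Real.exp (-catL * n) * |catV x - catV y|) := by
            rw [← mul_assoc, ← Real.exp_add]
            simp
        _ < Real.exp (catL * n) * (2 * (1 * Real.exp (-α * n))) := by gcongr
        _ = 2 * Real.exp (catL * n + -α * n) := by rw [Real.exp_add]; ring
        _ = _ := by ring_nf

theorem eq_of_abs_natCast_mul_sub_mul_lt {i j : ℕ} {δ : ℝ} (hδ : 0 < δ)
    (h : |i * δ - j * δ| < δ) : i = j := by
  rw [← sub_mul, abs_mul, abs_of_pos hδ, mul_lt_iff_lt_one_left hδ] at h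
  have : |(i : ℤ) - j| < 1 := by exact_mod_cast h
  have := Int.abs_lt_one_iff.1 this
  lia

theorem card_ge_of_spanning_catMap {α : ℝ} {n : ℕ} {S : Finset (EuclideanSpace ℝ (Fin 2))}
    (hS : ∀ x ∈ unitSquare, ∃ y ∈ S, ∀ t : ℕ, t ≤ n →
        dist (catMap^[t] x) (catMap^[t] y) < 1 * Real.exp (-α * t)) :
    1 / 64 * Real.exp ((catL + α + catB α) * n) ≤ S.card := by
  set δ₁ := 4 * Real.exp (-(catL + α) * n) with hδ₁
  set δ₂ := 4 * Real.exp (-catB α * n) with hδ₂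
  have hp₁ : 0 < δ₁ := by positivity
  have hp₂ : 0 < δ₂ := by positivity
  set N₁ := ⌈1 / 2 / δ₁⌉₊
  set N₂ := ⌈1 / 2 / δ₂⌉₊
  let P : ℕ × ℕ → EuclideanSpace ℝ (Fin 2) := fun i => catPoint (i.1 * δ₁) (i.2 * δ₂)
  have hmem : ∀ i ∈ Finset.range N₁ ×ˢ Finset.range N₂, P i ∈ unitSquare := by
    intro i hi
    rw [Finset.mem_product, Finset.mem_range, Finset.mem_range, Nat.lt_ceil, Nat.lt_ceil,
      lt_div_iff₀ hp₁, lt_div_iff₀ hp₂] at hi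
    exact catPoint_mem_unitSquare ⟨by positivity, hi.1.le⟩ ⟨by positivity, hi.2.le⟩
  have hcard : (Finset.range N₁ ×ˢ Finset.range N₂).card ≤ S.card := by
    choose! f hfS hf using hS
    refine Finset.card_le_card_of_injOn (fun i => f (P i)) (fun i hi => hfS _ (hmem i hi)) ?_
    intro i hi j hj hij
    obtain ⟨hiu, hiv⟩ := abs_sub_lt_of_dist_iterate_lt (hf _ (hmem i hi))
    obtain ⟨hju, hjv⟩ := abs_sub_lt_of_dist_iterate_lt (hf _ (hmem j hj))
    simp only at hij
    rw [← hij, abs_sub_comm] at hju hjv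
    have hu := abs_sub_le (catU (P i)) (catU (f (P i))) (catU (P j))
    have hv := abs_sub_le (catV (P i)) (catV (f (P i))) (catV (P j))
    simp only [P, catU_catPoint, catV_catPoint, add_sub_add_left_eq_sub] at hu hv hiu hiv hju hjv
    exact Prod.ext (eq_of_abs_natCast_mul_sub_mul_lt hp₁ (by linarith))
      (eq_of_abs_natCast_mul_sub_mul_lt hp₂ (by linarith))
  rw [Finset.card_product, Finset.card_range, Finset.card_range] at hcard
  calc 1 / 64 * Real.exp ((catL + α + catB α) * n) = 1 / 2 / δ₁ * (1 / 2 / δ₂) := by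
        rw [add_mul, Real.exp_add, hδ₁, hδ₂, neg_mul, neg_mul, Real.exp_neg, Real.exp_neg]
        field_simp
        norm_num
    _ ≤ N₁ * N₂ := by
        gcongr
        · exact Nat.le_ceil _
        · exact Nat.le_ceil _
    _ ≤ S.card := by exact_mod_cast hcard

theorem le_spanNum_catMap {α : ℝ} (hα : 0 ≤ α) (n : ℕ) :
    1 / 64 * Real.exp ((catL + α + catB α) * n) ≤ spanNum catMap unitSquare α n 1 := by
  obtain ⟨S₀, hSK₀, -, hS₀⟩ := exists_spanning_catMap hα one_pos n
  obtain ⟨S, -, hcard, hS⟩ := Nat.sInf_mem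
    (s := {m : ℕ | ∃ S : Finset (EuclideanSpace ℝ (Fin 2)), ↑S ⊆ unitSquare ∧ S.card = m ∧
      ∀ x ∈ unitSquare, ∃ y ∈ S, ∀ t : ℕ, t ≤ n →
        dist (catMap^[t] x) (catMap^[t] y) < 1 * Real.exp (-α * t)}) ⟨_, S₀, hSK₀, rfl, hS₀⟩
  rw [spanNum, ← hcard]
  exact card_ge_of_spanning_catMap hS

theorem tendsto_log_mul_exp_div {C : ℝ} (hC : 0 < C) (h : ℝ) :
    Tendsto (fun n : ℕ => ((Real.log (C * Real.exp (h * n)) / n : ℝ) : EReal)) atTop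
      (nhds (h : EReal)) := by
  refine (continuous_coe_real_ereal.tendsto h).comp ?_
  have h1 : Tendsto (fun n : ℕ => Real.log C / n + h) atTop (nhds (0 + h)) :=
    (tendsto_const_div_atTop_nhds_zero_nat _).add tendsto_const_nhds
  rw [zero_add] at h1
  refine h1.congr' ?_
  filter_upwards [eventually_ne_atTop 0] with n hn
  have hn' : (n : ℝ) ≠ 0 := by exact_mod_cast hn
  rw [Real.log_mul hC.ne' (Real.exp_pos _).ne', Real.log_exp, add_div, mul_div_cancel_right₀ _ hn']

theorem estEntropy_catMap {α : ℝ} (hα : 0 ≤ α) :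
    estEntropy catMap unitSquare α = ((catL + α + catB α : ℝ) : EReal) := by
  have hpos : ∀ n, 0 < 1 / 64 * Real.exp ((catL + α + catB α) * (n : ℕ)) :=
    fun n => by positivity
  apply le_antisymm
  · refine iSup₂_le fun ε hε => ?_
    have hε' : 0 < ε := hε
    rw [← (tendsto_log_mul_exp_div (C := max 1 ((2 * (6 + ε) / ε) ^ 2)) (by positivity)
      (catL + α + catB α)).limsup_eq]
    refine limsup_le_limsup (Eventually.of_forall fun n => ?_)
    have hle : (spanNum catMap unitSquare α n ε : ℝ)
        ≤ max 1 ((2 * (6 + ε) / ε) ^ 2) * Real.exp ((catL + α + catB α) * n) :=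
      (spanNum_catMap_le hα hε n).trans (by gcongr; exact le_max_right _ _)
    rw [EReal.coe_le_coe_iff]
    gcongr ?_ / _
    rcases Nat.eq_zero_or_pos (spanNum catMap unitSquare α n ε) with h0 | h0
    · rw [h0, Nat.cast_zero, Real.log_zero]
      have hL := catL_pos
      have hb : 0 ≤ catB α := le_max_left _ _
      refine Real.log_nonneg (one_le_mul_of_one_le_of_one_le (le_max_left _ _) ?_)
      exact Real.one_le_exp (by positivity)
    · exact Real.log_le_log (by exact_mod_cast h0) hle
  · refine le_trans ?_ (le_iSup₂ (1 : ℝ) (Set.mem_Ioi.2 one_pos))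
    rw [← (tendsto_log_mul_exp_div (C := 1 / 64) (by positivity) (catL + α + catB α)).limsup_eq]
    refine limsup_le_limsup (Eventually.of_forall fun n => ?_)
    rw [EReal.coe_le_coe_iff]
    gcongr ?_ / _
    exact Real.log_le_log (hpos n) (le_spanNum_catMap hα n)

/-- For the linear map `A = [[2,1],[1,1]]` on `ℝ²` with the Euclidean
metric, `K = [0,1]²` and `γ = (3+√5)/2`, the estimation entropy (natural logarithm)
satisfies `h_est(α,K;A) = α + ln γ` for `0 ≤ α ≤ ln γ` and `h_est(α,K;A) = 2α` for
`α ≥ ln γ`; equivalently `h_est(α,K;A) = (ln γ + α)⁺ + (−ln γ + α)⁺`. -/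
theorem estEntropy_cat_linear (α : ℝ) (hα : 0 ≤ α) :
    (α ≤ Real.log ((3 + Real.sqrt 5) / 2) →
      estEntropy catMap unitSquare α
        = ((α + Real.log ((3 + Real.sqrt 5) / 2) : ℝ) : EReal)) ∧
    (Real.log ((3 + Real.sqrt 5) / 2) ≤ α →
      estEntropy catMap unitSquare α = ((2 * α : ℝ) : EReal)) ∧
    estEntropy catMap unitSquare α
      = ((max 0 (Real.log ((3 + Real.sqrt 5) / 2) + α)
          + max 0 (-Real.log ((3 + Real.sqrt 5) / 2) + α) : ℝ) : EReal) := by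
  have hmain := estEntropy_catMap hα
  have hL := catL_pos
  rw [← catL, hmain]
  refine ⟨fun h => ?_, fun h => ?_, ?_⟩
  · rw [catB, max_eq_left (by linarith), add_zero, add_comm]
  · rw [catB, max_eq_right (by linarith)]
    ring_nf
  · rw [catB, max_eq_right (a := 0) (b := catL + α) (by linarith)]
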